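/- Let 𝔽 be a field of characteristic 0, let n ≥ 3, and let 𝔮 = (q_{ij}) be a multiplicatively antisymmetric n×n matrix over 𝔽 such that for exactly one pair i' < j' one has q_{i'j'} = 1, while q_{ij} ≠ 1 for every other pair i < j. Then every 𝔽-algebra automorphism of 𝒪_𝔮 is scalar if and only if both of the following hold: (a) Λ_i is empty for every i (i.e. E = 0), and (b) there do not exist a permutation π₁ of the set {i',j'} and a non-identity permutation π₂ of the set J = {1,…,n}∖{i',j'} such that q_{i'r} = q_{π₁(i')π₂(r)} and q_{j'r} = q_{π₁(j')π₂(r)} for all r ∈ J, and q_{rs} = q_{π₂(r)π₂(s)} for all r,s ∈ J. -/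

import Mathlib

/-- The defining relations of the multiparameter quantum affine space:
`X i * X j = q i j • (X j * X i)` for `i < j`. -/
inductive QuantumRel (F : Type*) [Field F] (n : ℕ) (q : Fin n → Fin n → F) :
    FreeAlgebra F (Fin n) → FreeAlgebra F (Fin n) → Prop
  | rel (i j : Fin n) (h : i < j) :
      QuantumRel F n q (FreeAlgebra.ι F i * FreeAlgebra.ι F j)
        (q i j • (FreeAlgebra.ι F j * FreeAlgebra.ι F i))

/-- The multiparameter quantum affine space `𝒪_𝔮`. -/
abbrev QuantumAffineSpace (F : Type*) [Field F] (n : ℕ) (q : Fin n → Fin n → F) :=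
  RingQuot (QuantumRel F n q)

/-- The canonical generators `X i` of the quantum affine space. -/
noncomputable def QX (F : Type*) [Field F] (n : ℕ) (q : Fin n → Fin n → F) (i : Fin n) :
    QuantumAffineSpace F n q :=
  RingQuot.mkAlgHom F (QuantumRel F n q) (FreeAlgebra.ι F i)

/-- A multiplicatively antisymmetric matrix: nonzero entries, `q i i = 1`, `q j i = (q i j)⁻¹`. -/
def MultAntisym (F : Type*) [Field F] {n : ℕ} (q : Fin n → Fin n → F) : Prop :=
  (∀ i j, q i j ≠ 0) ∧ (∀ i, q i i = 1) ∧ (∀ i j, q j i = (q i j)⁻¹)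

/-- An `F`-algebra automorphism of the quantum affine space is scalar if it sends each
generator `X i` to a nonzero scalar multiple of itself. -/
def IsScalarAut (F : Type*) [Field F] (n : ℕ) (q : Fin n → Fin n → F)
    (σ : QuantumAffineSpace F n q ≃ₐ[F] QuantumAffineSpace F n q) : Prop :=
  ∃ a : Fin n → F, (∀ i, a i ≠ 0) ∧ ∀ i, σ (QX F n q i) = a i • QX F n q i

/-- `E = 0`: each set `Λ_i` is empty. -/
def LambdaEmpty (F : Type*) [Field F] {n : ℕ} (q : Fin n → Fin n → F) : Prop :=
  ∀ i : Fin n, ∀ ν : Fin n → ℕ,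
    ¬ (ν i = 0 ∧ ∀ j, j ≠ i → (∏ k, q k j ^ ν k) = q i j)

/-- The `λ`-group: the subgroup of `Fˣ` generated by the multiparameters `q i j`, `i < j`. -/
def lambdaGroup (F : Type*) [Field F] {n : ℕ} (q : Fin n → Fin n → F) : Subgroup Fˣ :=
  Subgroup.closure {u : Fˣ | ∃ i j : Fin n, i < j ∧ (u : F) = q i j}

section QuantumAffineSpace

variable {F : Type*} [Field F] {n : ℕ} {q : Fin n → Fin n → F}

namespace MultAntisym

theorem mul_swap (hq : MultAntisym F q) (i j : Fin n) : q i j * q j i = 1 := by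
  rw [hq.2.2 i j, mul_inv_cancel₀ (hq.1 i j)]

end MultAntisym

namespace QuantumAffineSpace

theorem QX_mul_QX (hq : MultAntisym F q) (i j : Fin n) :
    QX F n q i * QX F n q j = q i j • (QX F n q j * QX F n q i) := by
  have key : ∀ i j, i < j →
      QX F n q i * QX F n q j = q i j • (QX F n q j * QX F n q i) := fun i j h => by
    simpa [QX] using RingQuot.mkAlgHom_rel F (QuantumRel.rel (q := q) i j h)
  rcases lt_trichotomy i j with h | rfl | h
  · exact key i j h
  · simp [hq.2.1]
  · rw [key j i h, smul_smul, hq.mul_swap, one_smul]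

/-- The universal property of the quantum affine space. -/
noncomputable def lift {A : Type*} [Ring A] [Algebra F A] (Y : Fin n → A)
    (hY : ∀ i j, i < j → Y i * Y j = q i j • (Y j * Y i)) :
    QuantumAffineSpace F n q →ₐ[F] A :=
  RingQuot.liftAlgHom F ⟨FreeAlgebra.lift F Y, fun {x y} h => by
    cases h with
    | rel i j h => simpa using hY i j h⟩

@[simp]
theorem lift_QX {A : Type*} [Ring A] [Algebra F A] (Y : Fin n → A)
    (hY : ∀ i j, i < j → Y i * Y j = q i j • (Y j * Y i)) (i : Fin n) :
    lift Y hY (QX F n q i) = Y i := by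
  simp [lift, QX]

theorem algHom_ext {A : Type*} [Ring A] [Algebra F A] {f g : QuantumAffineSpace F n q →ₐ[F] A}
    (h : ∀ i, f (QX F n q i) = g (QX F n q i)) : f = g := by
  apply RingQuot.ringQuot_ext'
  apply FreeAlgebra.hom_ext
  funext i
  exact h i

variable (F q) in
/-- The monomial spelled by a word in the generators. -/
noncomputable def word (l : List (Fin n)) : QuantumAffineSpace F n q :=
  (l.map (QX F n q)).prod

@[simp] theorem word_nil : word F q [] = 1 := rfl

@[simp] theorem word_cons (i : Fin n) (l : List (Fin n)) :
    word F q (i :: l) = QX F n q i * word F q l := rfl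

theorem word_append (l l' : List (Fin n)) :
    word F q (l ++ l') = word F q l * word F q l' := by
  simp [word]

theorem exists_word_eq_smul_of_perm (hq : MultAntisym F q) {l l' : List (Fin n)}
    (h : l.Perm l') : ∃ c : F, c ≠ 0 ∧ word F q l = c • word F q l' := by
  induction h with
  | nil => exact ⟨1, one_ne_zero, by simp⟩
  | cons x _ ih =>
    obtain ⟨c, hc, h⟩ := ih
    exact ⟨c, hc, by simp [h]⟩
  | swap x y l =>
    refine ⟨q y x, hq.1 y x, ?_⟩
    simp only [word_cons]
    rw [← mul_assoc, QX_mul_QX hq, smul_mul_assoc, mul_assoc]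
  | trans _ _ ih ih' =>
    obtain ⟨c, hc, h⟩ := ih
    obtain ⟨c', hc', h'⟩ := ih'
    exact ⟨c * c', mul_ne_zero hc hc', by rw [h, h', smul_smul]⟩

/-- If `f` commutes up to scalars with every generator, it does so with every word. -/
theorem word_mul_of_forall_QX_mul {f : QuantumAffineSpace F n q} {d : Fin n → F}
    (h : ∀ k, QX F n q k * f = d k • (f * QX F n q k)) (l : List (Fin n)) :
    word F q l * f = (l.map d).prod • (f * word F q l) := by
  induction l with
  | nil => simp
  | cons k l ih =>
    rw [word_cons, mul_assoc, ih, mul_smul_comm, ← mul_assoc, h, smul_mul_assoc, smul_smul,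
      mul_assoc, List.map_cons, List.prod_cons, mul_comm]

theorem span_range_word : Submodule.span F (Set.range (word F q)) = ⊤ := by
  rw [eq_top_iff]
  rintro x -
  obtain ⟨x, rfl⟩ := RingQuot.mkAlgHom_surjective F (QuantumRel F n q) x
  have hx : x ∈ Submodule.span F
      (Submonoid.closure (Set.range (FreeAlgebra.ι F : Fin n → _)) :
        Set (FreeAlgebra F (Fin n))) := by
    rw [← Algebra.adjoin_eq_span, FreeAlgebra.adjoin_range_ι]
    trivial
  induction hx using Submodule.span_induction with
  | mem x hx =>
    apply Submodule.subset_span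
    induction hx using Submonoid.closure_induction with
    | mem x hx =>
      obtain ⟨i, rfl⟩ := hx
      exact ⟨[i], by simp [QX]⟩
    | one => exact ⟨[], by simp⟩
    | mul x y _ _ hx hy =>
      obtain ⟨l, hl⟩ := hx
      obtain ⟨l', hl'⟩ := hy
      exact ⟨l ++ l', by rw [word_append, hl, hl', map_mul]⟩
  | zero => simp
  | add x y _ _ hx hy =>
    rw [map_add]
    exact add_mem hx hy
  | smul a x _ hx =>
    rw [map_smul]
    exact Submodule.smul_mem _ a hx

variable (F q) in
/-- The monomial with a given multiset of factors, in an arbitrarily chosen order. -/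
noncomputable def monomial (s : Multiset (Fin n)) : QuantumAffineSpace F n q :=
  word F q s.toList

@[simp] theorem monomial_zero : monomial F q 0 = 1 := by simp [monomial]

@[simp] theorem monomial_singleton (i : Fin n) : monomial F q {i} = QX F n q i := by
  simp [monomial]

theorem exists_word_eq_smul_monomial (hq : MultAntisym F q) (l : List (Fin n)) :
    ∃ c : F, c ≠ 0 ∧ word F q l = c • monomial F q l :=
  exists_word_eq_smul_of_perm hq (by rw [← Multiset.coe_eq_coe, Multiset.coe_toList])

theorem exists_monomial_mul_monomial (hq : MultAntisym F q) (s t : Multiset (Fin n)) :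
    ∃ c : F, c ≠ 0 ∧ monomial F q s * monomial F q t = c • monomial F q (s + t) := by
  obtain ⟨c, hc, h⟩ := exists_word_eq_smul_monomial hq (s.toList ++ t.toList)
  refine ⟨c, hc, ?_⟩
  rw [monomial, monomial, ← word_append, h, ← Multiset.coe_add, Multiset.coe_toList,
    Multiset.coe_toList]

theorem monomial_mul_of_forall_QX_mul {f : QuantumAffineSpace F n q} {d : Fin n → F}
    (h : ∀ k, QX F n q k * f = d k • (f * QX F n q k)) (s : Multiset (Fin n)) :
    monomial F q s * f = (s.map d).prod • (f * monomial F q s) := by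
  rw [monomial, word_mul_of_forall_QX_mul h, ← Multiset.prod_coe, ← Multiset.map_coe,
    Multiset.coe_toList]

theorem monomial_mul_QX (hq : MultAntisym F q) (s : Multiset (Fin n)) (j : Fin n) :
    monomial F q s * QX F n q j = (s.map (q · j)).prod • (QX F n q j * monomial F q s) :=
  monomial_mul_of_forall_QX_mul (fun k => QX_mul_QX hq k j) s

variable (q) in
/-- The factor picked up when `X i` is inserted into an ordered monomial. -/
noncomputable def insertFactor (i : Fin n) (s : Multiset (Fin n)) : F :=
  (s.map fun k => if k < i then q i k else 1).prod

theorem insertFactor_ne_zero (hq : MultAntisym F q) (i : Fin n) (s : Multiset (Fin n)) :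
    insertFactor q i s ≠ 0 := by
  refine Multiset.prod_ne_zero fun h => ?_
  obtain ⟨k, -, hk⟩ := Multiset.mem_map.1 h
  split_ifs at hk
  · exact hq.1 _ _ hk
  · exact one_ne_zero hk

theorem insertFactor_cons (i j : Fin n) (s : Multiset (Fin n)) :
    insertFactor q i (j ::ₘ s) = (if j < i then q i j else 1) * insertFactor q i s := by
  simp [insertFactor]

variable (q) in
/-- The action of `X i` on formal ordered monomials. -/
noncomputable def insertOp (i : Fin n) : Module.End F (Multiset (Fin n) →₀ F) :=
  Finsupp.linearCombination F fun s => insertFactor q i s • Finsupp.single (i ::ₘ s) 1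

theorem insertOp_single (i : Fin n) (s : Multiset (Fin n)) :
    insertOp q i (Finsupp.single s 1) = insertFactor q i s • Finsupp.single (i ::ₘ s) 1 := by
  simp [insertOp]

theorem insertOp_mul_insertOp (hq : MultAntisym F q) (i j : Fin n) (h : i < j) :
    insertOp q i * insertOp q j = q i j • (insertOp q j * insertOp q i) := by
  refine Finsupp.lhom_ext' fun s => LinearMap.ext_ring ?_
  simp only [LinearMap.comp_apply, Finsupp.lsingle_apply, Module.End.mul_apply,
    LinearMap.smul_apply, insertOp_single, map_smul, smul_smul, insertFactor_cons, h, h.not_gt,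
    if_true, if_false, one_mul, Multiset.cons_swap i j]
  congr 1
  linear_combination (-insertFactor q i s * insertFactor q j s) * hq.mul_swap i j

/-- The representation of the quantum affine space on formal ordered monomials. -/
noncomputable def monomialRep (hq : MultAntisym F q) :
    QuantumAffineSpace F n q →ₐ[F] Module.End F (Multiset (Fin n) →₀ F) :=
  lift (insertOp q) (insertOp_mul_insertOp hq)

theorem exists_monomialRep_word (hq : MultAntisym F q) (l : List (Fin n)) :
    ∃ c : F, c ≠ 0 ∧ monomialRep hq (word F q l) (Finsupp.single 0 1) =
      c • Finsupp.single (l : Multiset (Fin n)) 1 := by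
  induction l with
  | nil => exact ⟨1, one_ne_zero, by simp⟩
  | cons i l ih =>
    obtain ⟨c, hc, h⟩ := ih
    refine ⟨c * insertFactor q i l, mul_ne_zero hc (insertFactor_ne_zero hq _ _), ?_⟩
    rw [word_cons, map_mul, Module.End.mul_apply, h, map_smul, monomialRep, lift_QX,
      insertOp_single, smul_smul, Multiset.cons_coe]

theorem linearIndependent_monomial (hq : MultAntisym F q) :
    LinearIndependent F (monomial F q) := by
  choose c hc h using fun s : Multiset (Fin n) => exists_monomialRep_word hq s.toList
  let φ : QuantumAffineSpace F n q →ₗ[F] (Multiset (Fin n) →₀ F) :=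
    (LinearMap.applyₗ (Finsupp.single 0 1)).comp (monomialRep hq).toLinearMap
  refine LinearIndependent.of_comp φ ?_
  have hli := (Finsupp.basisSingleOne (R := F) (ι := Multiset (Fin n))).linearIndependent.units_smul
    fun s => Units.mk0 (c s) (hc s)
  convert hli using 1
  funext s
  simpa [φ, monomial, Units.smul_def] using h s

theorem top_le_span_monomial (hq : MultAntisym F q) :
    ⊤ ≤ Submodule.span F (Set.range (monomial F q)) := by
  rw [← span_range_word, Submodule.span_le]
  rintro _ ⟨l, rfl⟩
  obtain ⟨c, -, h⟩ := exists_word_eq_smul_monomial hq l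
  rw [h]
  exact Submodule.smul_mem _ _ (Submodule.subset_span ⟨_, rfl⟩)

/-- The monomial basis of the quantum affine space. -/
noncomputable def basis (hq : MultAntisym F q) :
    Module.Basis (Multiset (Fin n)) F (QuantumAffineSpace F n q) :=
  Module.Basis.mk (linearIndependent_monomial hq) (top_le_span_monomial hq)

@[simp]
theorem basis_apply (hq : MultAntisym F q) (s : Multiset (Fin n)) :
    basis hq s = monomial F q s := by
  simp [basis]

theorem repr_monomial (hq : MultAntisym F q) (s : Multiset (Fin n)) :
    (basis hq).repr (monomial F q s) = Finsupp.single s 1 := by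
  rw [← basis_apply hq, Module.Basis.repr_self]

theorem repr_QX (hq : MultAntisym F q) (i : Fin n) :
    (basis hq).repr (QX F n q i) = Finsupp.single {i} 1 := by
  rw [← monomial_singleton, repr_monomial]

theorem sum_repr (hq : MultAntisym F q) (x : QuantumAffineSpace F n q) :
    ∑ s ∈ ((basis hq).repr x).support, (basis hq).repr x s • monomial F q s = x := by
  have h := (basis hq).linearCombination_repr x
  rw [Finsupp.linearCombination_apply, Finsupp.sum] at h
  simpa using h

theorem eq_repr_smul_monomial (hq : MultAntisym F q) {x : QuantumAffineSpace F n q}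
    {s : Multiset (Fin n)} (h : ∀ t, (basis hq).repr x t ≠ 0 → t = s) :
    x = (basis hq).repr x s • monomial F q s := by
  apply (basis hq).repr.injective
  ext t
  rw [map_smul, repr_monomial]
  by_cases hts : t = s
  · simp [hts]
  · simpa [Finsupp.single_apply, Ne.symm hts] using not_imp_comm.1 (h t) hts

variable (hq : MultAntisym F q) {Γ : Type*} [AddCommMonoid Γ] [LinearOrder Γ]
  (k : Multiset (Fin n) →+ Γ)

/-- `s` is the exponent of the leading monomial of `x`, for the ordering of monomials by `k`. -/
def IsLeading (x : QuantumAffineSpace F n q) (s : Multiset (Fin n)) : Prop :=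
  (basis hq).repr x s ≠ 0 ∧ ∀ t, (basis hq).repr x t ≠ 0 → k t ≤ k s

theorem exists_isLeading {x : QuantumAffineSpace F n q} (hx : x ≠ 0) :
    ∃ s, IsLeading hq k x s := by
  have hne : ((basis hq).repr x).support.Nonempty := by
    simpa [Finsupp.support_nonempty_iff] using hx
  obtain ⟨s, hs, h⟩ := Finset.exists_max_image _ k hne
  exact ⟨s, Finsupp.mem_support_iff.1 hs, fun t ht => h t (Finsupp.mem_support_iff.2 ht)⟩

theorem isLeading_monomial (s : Multiset (Fin n)) : IsLeading hq k (monomial F q s) s := by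
  refine ⟨by simp [repr_monomial], fun t ht => ?_⟩
  rw [repr_monomial, Finsupp.single_apply_ne_zero] at ht
  rw [ht.1]

variable {hq k}

theorem IsLeading.unique (hk : Function.Injective k) {x : QuantumAffineSpace F n q}
    {s t : Multiset (Fin n)} (hs : IsLeading hq k x s) (ht : IsLeading hq k x t) : s = t :=
  hk (le_antisymm (ht.2 s hs.1) (hs.2 t ht.1))

theorem IsLeading.mul [IsOrderedCancelAddMonoid Γ] (hk : Function.Injective k)
    {x y : QuantumAffineSpace F n q} {s t : Multiset (Fin n)}
    (hs : IsLeading hq k x s) (ht : IsLeading hq k y t) :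
    IsLeading hq k (x * y) (s + t) := by
  choose c hc hmul using exists_monomial_mul_monomial hq
  have hrepr : ∀ u, (basis hq).repr (x * y) u =
      ∑ a ∈ ((basis hq).repr x).support, ∑ b ∈ ((basis hq).repr y).support,
        if a + b = u then (basis hq).repr x a * (basis hq).repr y b * c a b else 0 := by
    intro u
    conv_lhs => rw [← sum_repr hq x, ← sum_repr hq y]
    simp only [Finset.sum_mul, Finset.mul_sum, map_sum, Finsupp.coe_finsetSum, Finset.sum_apply]
    rw [Finset.sum_comm]
    refine Finset.sum_congr rfl fun a _ => Finset.sum_congr rfl fun b _ => ?_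
    rw [smul_mul_smul_comm, hmul, smul_smul, map_smul, repr_monomial, Finsupp.smul_single_one,
      Finsupp.single_apply]
  constructor
  · rw [hrepr, Finset.sum_eq_single s, Finset.sum_eq_single t, if_pos rfl]
    · exact mul_ne_zero (mul_ne_zero hs.1 ht.1) (hc s t)
    · intro b _ hb
      exact if_neg fun h => hb (add_left_cancel h)
    · intro h
      exact absurd ht.1 (by simpa using h)
    · intro a ha has
      refine Finset.sum_eq_zero fun b hb => if_neg fun h => has ?_
      have hlt : k a < k s := (hs.2 a (Finsupp.mem_support_iff.1 ha)).lt_of_ne (hk.ne has)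
      have := add_lt_add_of_lt_of_le hlt (ht.2 b (Finsupp.mem_support_iff.1 hb))
      rw [← map_add, ← map_add, h] at this
      exact absurd this (lt_irrefl _)
    · intro h
      exact absurd hs.1 (by simpa using h)
  · intro u hu
    rw [hrepr] at hu
    obtain ⟨a, ha, hu⟩ := Finset.exists_ne_zero_of_sum_ne_zero hu
    obtain ⟨b, hb, hu⟩ := Finset.exists_ne_zero_of_sum_ne_zero hu
    have hab : a + b = u := by
      by_contra h
      exact hu (if_neg h)
    rw [← hab, map_add, map_add]
    exact add_le_add (hs.2 a (Finsupp.mem_support_iff.1 ha))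
      (ht.2 b (Finsupp.mem_support_iff.1 hb))

/-- The lexicographic ordering of monomials. -/
noncomputable def lexKey (n : ℕ) : Multiset (Fin n) →+ Lex (Fin n →₀ ℕ) where
  toFun s := toLex (Multiset.toFinsupp s)
  map_zero' := by simp
  map_add' s t := by simp

theorem lexKey_injective (n : ℕ) : Function.Injective (lexKey n) := fun _ _ h =>
  Multiset.toFinsupp.injective (toLex.injective h)

/-- The reversed lexicographic ordering of monomials. -/
noncomputable def lexKeyDual (n : ℕ) : Multiset (Fin n) →+ (Lex (Fin n →₀ ℕ))ᵒᵈ where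
  toFun s := OrderDual.toDual (lexKey n s)
  map_zero' := by simp
  map_add' s t := by simp

theorem lexKeyDual_injective (n : ℕ) : Function.Injective (lexKeyDual n) := fun _ _ h =>
  lexKey_injective n (OrderDual.toDual.injective h)

/-- An element whose greatest and least exponents agree is a multiple of a monomial. -/
theorem eq_smul_monomial_of_isLeading {x : QuantumAffineSpace F n q} {s : Multiset (Fin n)}
    (h : IsLeading hq (lexKey n) x s) (h' : IsLeading hq (lexKeyDual n) x s) :
    x = (basis hq).repr x s • monomial F q s :=
  eq_repr_smul_monomial hq fun t ht => lexKey_injective n (le_antisymm (h.2 t ht) (h'.2 t ht))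

theorem mul_ne_zero_of_ne_zero (hq : MultAntisym F q) {x y : QuantumAffineSpace F n q}
    (hx : x ≠ 0) (hy : y ≠ 0) : x * y ≠ 0 := by
  obtain ⟨s, hs⟩ := exists_isLeading hq (lexKey n) hx
  obtain ⟨t, ht⟩ := exists_isLeading hq (lexKey n) hy
  intro h
  simpa [h] using (hs.mul (lexKey_injective n) ht).1

theorem QX_ne_zero (hq : MultAntisym F q) (i : Fin n) : QX F n q i ≠ 0 :=
  fun h => Finsupp.single_ne_zero.2 one_ne_zero (by rw [← repr_QX hq i, h, map_zero])

theorem eq_smul_one_of_mul_eq_one (hq : MultAntisym F q) {x y : QuantumAffineSpace F n q}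
    (h : x * y = 1) : ∃ a : F, x = a • 1 := by
  have hone : (1 : QuantumAffineSpace F n q) ≠ 0 := fun h =>
    Finsupp.single_ne_zero.2 one_ne_zero
      (by rw [← repr_monomial hq 0, monomial_zero, h, map_zero])
  have hx : x ≠ 0 := by rintro rfl; exact hone (by simpa using h.symm)
  have hy : y ≠ 0 := by rintro rfl; exact hone (by simpa using h.symm)
  have key : ∀ {Γ : Type} [AddCommMonoid Γ] [LinearOrder Γ] [IsOrderedCancelAddMonoid Γ]
      (k : Multiset (Fin n) →+ Γ), Function.Injective k → IsLeading hq k x 0 := by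
    intro Γ _ _ _ k hk
    obtain ⟨s, hs⟩ := exists_isLeading hq k hx
    obtain ⟨t, ht⟩ := exists_isLeading hq k hy
    have hst := hs.mul hk ht
    rw [h, ← monomial_zero] at hst
    have := hst.unique hk (isLeading_monomial hq k 0)
    rwa [(add_eq_zero.1 this).1] at hs
  refine ⟨(basis hq).repr x 0, ?_⟩
  rw [← monomial_zero]
  exact eq_smul_monomial_of_isLeading (key _ (lexKey_injective n)) (key _ (lexKeyDual_injective n))

/-- If `f * X j` is a left multiple of a nonzero `f`, then `f` and `X j` commute up to a scalar. -/
theorem exists_mul_QX_eq_smul (hq : MultAntisym F q) {f g : QuantumAffineSpace F n q}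
    (hf : f ≠ 0) {j : Fin n} (h : f * QX F n q j = g * f) :
    ∃ c : F, c ≠ 0 ∧ f * QX F n q j = c • (QX F n q j * f) := by
  have hfX := mul_ne_zero_of_ne_zero hq hf (QX_ne_zero hq j)
  have hg : g ≠ 0 := by rintro rfl; exact hfX (by simpa using h)
  have key : ∀ {Γ : Type} [AddCommMonoid Γ] [LinearOrder Γ] [IsOrderedCancelAddMonoid Γ]
      (k : Multiset (Fin n) →+ Γ), Function.Injective k → IsLeading hq k g {j} := by
    intro Γ _ _ _ k hk
    obtain ⟨s, hs⟩ := exists_isLeading hq k hg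
    obtain ⟨t, ht⟩ := exists_isLeading hq k hf
    have hj := ht.mul hk (isLeading_monomial hq k {j})
    rw [monomial_singleton, h] at hj
    have := (hs.mul hk ht).unique hk hj
    rw [add_comm] at this
    rwa [add_left_cancel this] at hs
  have hgX := eq_smul_monomial_of_isLeading (key _ (lexKey_injective n))
    (key _ (lexKeyDual_injective n))
  rw [monomial_singleton] at hgX
  refine ⟨_, (key _ (lexKey_injective n)).1, ?_⟩
  rw [h, ← smul_mul_assoc, ← hgX]

/-- If `f` commutes up to scalars with all monomials and with `g`, then all monomials of `g`
carry the same scalar. -/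
theorem eq_of_repr_ne_zero (hq : MultAntisym F q) {f g : QuantumAffineSpace F n q} (hf : f ≠ 0)
    {C : Multiset (Fin n) → F} {c : F}
    (hC : ∀ s, monomial F q s * f = C s • (f * monomial F q s)) (hg : g * f = c • (f * g))
    {s : Multiset (Fin n)} (hs : (basis hq).repr g s ≠ 0) : C s = c := by
  let T : QuantumAffineSpace F n q →ₗ[F] QuantumAffineSpace F n q :=
    (basis hq).constr F fun s => C s • monomial F q s
  have hT : ∀ x, x * f = f * T x := fun x => by
    have : LinearMap.mulRight F f = (LinearMap.mulLeft F f).comp T :=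
      (basis hq).ext fun s => by
        simp only [LinearMap.mulRight_apply, LinearMap.comp_apply, LinearMap.mulLeft_apply, T,
          Module.Basis.constr_basis, mul_smul_comm]
        rw [basis_apply, hC]
    exact LinearMap.congr_fun this x
  have hTg : T g = c • g := by
    by_contra hne
    refine mul_ne_zero_of_ne_zero hq hf (sub_ne_zero.2 hne) ?_
    rw [mul_sub, ← hT, hg, mul_smul_comm, sub_self]
  have hrepr : (basis hq).repr (T g) s = C s * (basis hq).repr g s := by
    have : (Finsupp.lapply s).comp ((basis hq).repr.toLinearMap.comp T) =
        C s • (Finsupp.lapply s).comp (basis hq).repr.toLinearMap :=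
      (basis hq).ext fun t => by
        simp only [LinearMap.comp_apply, T, Module.Basis.constr_basis, LinearEquiv.coe_coe,
          map_smul, repr_monomial, LinearMap.smul_apply, Module.Basis.repr_self,
          Finsupp.lapply_apply, smul_eq_mul, Finsupp.single_apply]
        split_ifs with hts
        · rw [hts]
        · simp
    exact LinearMap.congr_fun this g
  rw [hTg, map_smul, Finsupp.smul_apply, smul_eq_mul] at hrepr
  exact (mul_right_cancel₀ hs hrepr).symm

theorem prod_map_ne_zero (hq : MultAntisym F q) (s : Multiset (Fin n)) (j : Fin n) :
    (s.map (q · j)).prod ≠ 0 := by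
  refine Multiset.prod_ne_zero fun h => ?_
  obtain ⟨k, -, hk⟩ := Multiset.mem_map.1 h
  exact hq.1 _ _ hk

theorem exists_QX_mul_eq_mul_QX (hq : MultAntisym F q) (i : Fin n)
    (y : QuantumAffineSpace F n q) : ∃ z, QX F n q i * y = z * QX F n q i := by
  have hy := top_le_span_monomial hq (Submodule.mem_top (x := y))
  induction hy using Submodule.span_induction with
  | mem y hy =>
    obtain ⟨s, rfl⟩ := hy
    refine ⟨(s.map (q · i)).prod⁻¹ • monomial F q s, ?_⟩
    rw [smul_mul_assoc, monomial_mul_QX hq, inv_smul_smul₀ (prod_map_ne_zero hq s i)]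
  | zero => exact ⟨0, by simp⟩
  | add x y _ _ hx hy =>
    obtain ⟨x', hx⟩ := hx
    obtain ⟨y', hy⟩ := hy
    exact ⟨x' + y', by rw [mul_add, hx, hy, add_mul]⟩
  | smul a x _ hx =>
    obtain ⟨x', hx⟩ := hx
    exact ⟨a • x', by rw [mul_smul_comm, hx, smul_mul_assoc]⟩

section Automorphism

variable (σ : QuantumAffineSpace F n q ≃ₐ[F] QuantumAffineSpace F n q)

theorem map_QX_ne_zero (hq : MultAntisym F q) (i : Fin n) : σ (QX F n q i) ≠ 0 := by
  simpa using QX_ne_zero hq i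

theorem exists_map_QX_mul_QX (hq : MultAntisym F q) (i j : Fin n) :
    ∃ c : F, c ≠ 0 ∧ σ (QX F n q i) * QX F n q j = c • (QX F n q j * σ (QX F n q i)) := by
  obtain ⟨z, hz⟩ := exists_QX_mul_eq_mul_QX hq i (σ.symm (QX F n q j))
  refine exists_mul_QX_eq_smul hq (map_QX_ne_zero σ hq i) (g := σ z) ?_
  rw [← map_mul, ← hz, map_mul, AlgEquiv.apply_symm_apply]

variable {σ}

theorem prod_map_eq_of_repr_ne_zero (hq : MultAntisym F q) {f : QuantumAffineSpace F n q}
    {j : Fin n} {c : F} (h : f * QX F n q j = c • (QX F n q j * f)) {s : Multiset (Fin n)}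
    (hs : (basis hq).repr f s ≠ 0) : (s.map (q · j)).prod = c :=
  eq_of_repr_ne_zero hq (QX_ne_zero hq j) (fun s => monomial_mul_QX hq s j) h hs

theorem map_QX_mul_map_QX (hq : MultAntisym F q) (i j : Fin n) :
    σ (QX F n q i) * σ (QX F n q j) = q i j • (σ (QX F n q j) * σ (QX F n q i)) := by
  rw [← map_mul, QX_mul_QX hq, map_smul, map_mul]

/-- The scalars relating `σ (X i)` to the generators determine the relations between the images
of the generators. -/
theorem prod_map_inv_eq (hq : MultAntisym F q) {i j : Fin n} {c : Fin n → F} (hc : ∀ k, c k ≠ 0)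
    (h : ∀ k, σ (QX F n q i) * QX F n q k = c k • (QX F n q k * σ (QX F n q i)))
    {s : Multiset (Fin n)} (hs : (basis hq).repr (σ (QX F n q j)) s ≠ 0) :
    (s.map fun k => (c k)⁻¹).prod = q j i := by
  refine eq_of_repr_ne_zero hq (map_QX_ne_zero σ hq i)
    (monomial_mul_of_forall_QX_mul fun k => ?_) (map_QX_mul_map_QX hq j i) hs
  rw [h, inv_smul_smul₀ (hc k)]

theorem repr_map_QX_zero (hq : MultAntisym F q) {i j : Fin n} (hij : q i j ≠ 1) :
    (basis hq).repr (σ (QX F n q i)) 0 = 0 := by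
  by_contra h0
  choose c hc h using exists_map_QX_mul_QX σ hq i
  have hc1 : ∀ k, c k = 1 := fun k => by
    simpa using (prod_map_eq_of_repr_ne_zero hq (h k) h0).symm
  obtain ⟨s, hs⟩ := exists_isLeading hq (lexKey n) (map_QX_ne_zero σ hq j)
  have hji := prod_map_inv_eq hq hc h hs.1
  rw [hq.2.2 i j] at hji
  exact hij (by simpa [hc1] using hji.symm)

/-- The tangent vector `v` at the origin, as a point with values in the dual numbers. -/
noncomputable def tangent (v : Fin n → F) : QuantumAffineSpace F n q →ₐ[F] DualNumber F :=
  lift (fun i => TrivSqZeroExt.inr (v i)) fun i j _ => by simp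

theorem tangent_word (v : Fin n → F) (l : List (Fin n)) :
    tangent (q := q) v (word F q l) =
      TrivSqZeroExt.inl (Finsupp.single (l : Multiset (Fin n)) 1 0) +
      TrivSqZeroExt.inr (∑ k, v k * Finsupp.single (l : Multiset (Fin n)) 1 {k}) := by
  match l with
  | [] => simp
  | [a] =>
    simp only [word_cons, word_nil, mul_one, tangent, lift_QX, Multiset.coe_singleton,
      Finsupp.single_apply, Multiset.singleton_inj]
    simp
  | a :: b :: l =>
    have h : ∀ k, ((a :: b :: l : List (Fin n)) : Multiset (Fin n)) ≠ {k} := fun k h => by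
      simpa using congrArg Multiset.card h
    simp only [word_cons, map_mul, tangent, lift_QX, Finsupp.single_apply, h]
    simp [← mul_assoc]

theorem tangent_apply (hq : MultAntisym F q) (v : Fin n → F) (x : QuantumAffineSpace F n q) :
    tangent v x = TrivSqZeroExt.inl ((basis hq).repr x 0) +
      TrivSqZeroExt.inr (∑ k, v k * (basis hq).repr x {k}) := by
  have hx := top_le_span_monomial hq (Submodule.mem_top (x := x))
  induction hx using Submodule.span_induction with
  | mem x hx =>
    obtain ⟨s, rfl⟩ := hx
    rw [repr_monomial, monomial, tangent_word, Multiset.coe_toList]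
  | zero => simp
  | add x y _ _ hx hy =>
    rw [map_add, hx, hy]
    ext <;> simp [mul_add, Finset.sum_add_distrib]
  | smul a x _ hx =>
    rw [map_smul, hx]
    ext <;> simp [Finset.mul_sum, mul_left_comm]

theorem exists_perm (hq : MultAntisym F q) (hne : ∀ i, ∃ j, q i j ≠ 1) :
    ∃ π : Equiv.Perm (Fin n), (∀ i j, q i j = q (π i) (π j)) ∧
      ∀ i, (basis hq).repr (σ (QX F n q i)) {π i} ≠ 0 := by
  let L : Matrix (Fin n) (Fin n) F :=
    Matrix.of fun i k => (basis hq).repr (σ (QX F n q i)) {k}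
  have hL : ∀ v, (tangent v).comp σ.toAlgHom = tangent (q := q) (L.mulVec v) := fun v =>
    algHom_ext fun i => by
      obtain ⟨j, hj⟩ := hne i
      simp [tangent_apply hq, repr_map_QX_zero hq hj, repr_QX, Finsupp.single_apply, L,
        Matrix.mulVec, dotProduct, mul_comm]
  have hinj : Function.Injective L.mulVec := fun v w hvw => by
    have htan : tangent (q := q) v = tangent w := by
      refine AlgHom.ext fun x => ?_
      have h := (hL v).trans ((congrArg _ hvw).trans (hL w).symm)
      simpa using DFunLike.congr_fun h (σ.symm x)
    funext i
    have h := DFunLike.congr_fun htan (QX F n q i)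
    simp only [tangent, lift_QX] at h
    exact TrivSqZeroExt.inr_injective h
  have hdet : L.det ≠ 0 :=
    ((Matrix.isUnit_iff_isUnit_det L).1 (Matrix.mulVec_injective_iff_isUnit.1 hinj)).ne_zero
  rw [Matrix.det_apply] at hdet
  obtain ⟨ρ, -, hρ⟩ := Finset.exists_ne_zero_of_sum_ne_zero hdet
  have hρ' : ∀ i, L (ρ i) i ≠ 0 := fun i hi =>
    hρ (by
      rw [Finset.prod_eq_zero (f := fun i => L (ρ i) i) (Finset.mem_univ i) hi, smul_zero])
  have hsupp : ∀ i, (basis hq).repr (σ (QX F n q i)) {ρ.symm i} ≠ 0 := fun i => by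
    simpa [L] using hρ' (ρ.symm i)
  refine ⟨ρ.symm, fun i j => ?_, hsupp⟩
  choose c hc h using exists_map_QX_mul_QX σ hq i
  have h₁ := prod_map_inv_eq hq hc h (hsupp j)
  have h₂ := prod_map_eq_of_repr_ne_zero hq (h (ρ.symm j)) (hsupp i)
  simp only [Multiset.map_singleton, Multiset.prod_singleton] at h₁ h₂
  rw [h₂, hq.2.2 j i, ← h₁, inv_inv]

theorem prod_pow_count (s : Multiset (Fin n)) (j : Fin n) :
    ∏ k, q k j ^ s.count k = (s.map (q · j)).prod := by
  rw [Finset.prod_multiset_map_count]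
  refine (Finset.prod_subset (Finset.subset_univ _) fun k _ hk => ?_).symm
  rw [Multiset.count_eq_zero_of_notMem (by simpa using hk), pow_zero]

theorem exists_map_QX_eq_QX_mul (hq : MultAntisym F q) (hΛ : LambdaEmpty F q) {i : Fin n}
    (hi : (basis hq).repr (σ (QX F n q i)) {i} ≠ 0) :
    ∃ g, σ (QX F n q i) = QX F n q i * g := by
  have hmem : σ (QX F n q i) ∈ LinearMap.range (LinearMap.mulLeft F (QX F n q i)) := by
    rw [← sum_repr hq (σ (QX F n q i))]
    refine Submodule.sum_mem _ fun s hs => Submodule.smul_mem _ _ ?_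
    rw [Finsupp.mem_support_iff] at hs
    have his : i ∈ s := by
      by_contra his
      refine hΛ i (fun k => s.count k) ⟨Multiset.count_eq_zero_of_notMem his, fun j _ => ?_⟩
      obtain ⟨c, -, h⟩ := exists_map_QX_mul_QX σ hq i j
      rw [prod_pow_count, prod_map_eq_of_repr_ne_zero hq h hs,
        ← prod_map_eq_of_repr_ne_zero hq h hi]
      simp
    obtain ⟨t, rfl⟩ := Multiset.exists_cons_of_mem his
    obtain ⟨c, hc, h⟩ := exists_monomial_mul_monomial hq {i} t
    refine ⟨c⁻¹ • monomial F q t, ?_⟩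
    rw [LinearMap.mulLeft_apply, mul_smul_comm, ← monomial_singleton, h, inv_smul_smul₀ hc,
      Multiset.singleton_add]
  obtain ⟨g, hg⟩ := hmem
  exact ⟨g, hg.symm⟩

/-- If all automorphisms have `X i` in the linear part of the image of `X i` and all `Λ i` are
empty, then all automorphisms are scalar. -/
theorem isScalarAut_of_lambdaEmpty (hq : MultAntisym F q) (hΛ : LambdaEmpty F q)
    (h : ∀ (τ : QuantumAffineSpace F n q ≃ₐ[F] QuantumAffineSpace F n q) (i : Fin n),
      (basis hq).repr (τ (QX F n q i)) {i} ≠ 0) : IsScalarAut F n q σ := by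
  have key : ∀ i, ∃ a : F, σ (QX F n q i) = a • QX F n q i := fun i => by
    obtain ⟨g, hg⟩ := exists_map_QX_eq_QX_mul hq hΛ (h σ i)
    obtain ⟨g', hg'⟩ := exists_map_QX_eq_QX_mul hq hΛ (h σ.symm i)
    have hunit : g * σ g' = 1 := by
      by_contra hne
      refine mul_ne_zero_of_ne_zero hq (QX_ne_zero hq i) (sub_ne_zero.2 hne) ?_
      rw [mul_sub, ← mul_assoc, ← hg, ← map_mul, ← hg', AlgEquiv.apply_symm_apply, mul_one,
        sub_self]
    obtain ⟨a, ha⟩ := eq_smul_one_of_mul_eq_one hq hunit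
    exact ⟨a, by rw [hg, ha, mul_smul_comm, mul_one]⟩
  choose a ha using key
  refine ⟨a, fun i hi => map_QX_ne_zero σ hq i ?_, ha⟩
  rw [ha, hi, zero_smul]

end Automorphism

section Construction

variable (hq : MultAntisym F q)

/-- The transvection `X i ↦ X i + a X^s` attached to a monomial commuting with the other
generators in the same way as `X i`. -/
noncomputable def transvection (i : Fin n) (s : Multiset (Fin n))
    (h : ∀ j, j ≠ i → (s.map (q · j)).prod = q i j) (a : F) :
    QuantumAffineSpace F n q →ₐ[F] QuantumAffineSpace F n q :=
  lift (fun j => QX F n q j + if j = i then a • monomial F q s else 0) fun j k hjk => by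
    have hs : ∀ l, l ≠ i →
        monomial F q s * QX F n q l = q i l • (QX F n q l * monomial F q s) := fun l hl => by
      rw [monomial_mul_QX hq, h l hl]
    by_cases hj : j = i
    · subst hj
      rw [if_pos rfl, if_neg hjk.ne', add_zero, add_mul, mul_add, smul_add, QX_mul_QX hq,
        smul_mul_assoc, hs k hjk.ne', mul_smul_comm, smul_comm a]
    · by_cases hk : k = i
      · subst hk
        rw [if_pos rfl, if_neg hj, add_zero, add_mul, mul_add, smul_add, QX_mul_QX hq,
          smul_mul_assoc, hs j hj, mul_smul_comm, smul_comm a, smul_smul, hq.mul_swap, one_smul]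
      · rw [if_neg hj, if_neg hk, add_zero, add_zero, QX_mul_QX hq]

theorem transvection_monomial {i : Fin n} {s : Multiset (Fin n)}
    (h : ∀ j, j ≠ i → (s.map (q · j)).prod = q i j) (a : F) {t : Multiset (Fin n)}
    (ht : i ∉ t) : transvection hq i s h a (monomial F q t) = monomial F q t := by
  rw [monomial, word, map_list_prod, List.map_map]
  congr 1
  refine List.map_congr_left fun k hk => ?_
  have hki : k ≠ i := by
    rintro rfl
    exact ht (Multiset.mem_toList.1 hk)
  simp [transvection, hki]

theorem transvection_comp {i : Fin n} {s : Multiset (Fin n)}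
    (h : ∀ j, j ≠ i → (s.map (q · j)).prod = q i j) (hs : i ∉ s) {a b : F} (hab : a + b = 0) :
    (transvection hq i s h a).comp (transvection hq i s h b) =
      AlgHom.id F (QuantumAffineSpace F n q) := by
  refine algHom_ext fun j => ?_
  have hb : transvection hq i s h b (QX F n q j) =
      QX F n q j + if j = i then b • monomial F q s else 0 := by simp [transvection]
  have ha : transvection hq i s h a (QX F n q j) =
      QX F n q j + if j = i then a • monomial F q s else 0 := by simp [transvection]
  rw [AlgHom.comp_apply, hb, map_add, ha]
  split_ifs
  · rw [map_smul, transvection_monomial hq h a hs, add_assoc, ← add_smul, hab, zero_smul,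
      add_zero, AlgHom.id_apply]
  · simp

theorem lambdaEmpty_of_forall_isScalarAut (hq : MultAntisym F q)
    (H : ∀ σ : QuantumAffineSpace F n q ≃ₐ[F] QuantumAffineSpace F n q, IsScalarAut F n q σ) :
    LambdaEmpty F q := by
  rintro i ν ⟨hνi, hν⟩
  let s : Multiset (Fin n) := Finsupp.toMultiset (Finsupp.equivFunOnFinite.symm ν)
  have hcount : ∀ k, s.count k = ν k := fun k => by simp [s, Finsupp.count_toMultiset]
  have hs : i ∉ s := by rw [← Multiset.count_eq_zero, hcount, hνi]
  have h : ∀ j, j ≠ i → (s.map (q · j)).prod = q i j := fun j hj => by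
    rw [← prod_pow_count, ← hν j hj]
    simp only [hcount]
  obtain ⟨a, -, ha⟩ := H (AlgEquiv.ofAlgHom (transvection hq i s h 1) (transvection hq i s h (-1))
    (transvection_comp hq h hs (by simp)) (transvection_comp hq h hs (by simp)))
  have hsi : {i} ≠ s := fun h => hs (by simp [← h])
  have := congrArg (fun x => (basis hq).repr x s) (ha i)
  simp [transvection, repr_QX, repr_monomial, hsi] at this

/-- The endomorphism permuting the generators by a symmetry of `q`. -/
noncomputable def permHom (π : Equiv.Perm (Fin n)) (h : ∀ i j, q i j = q (π i) (π j)) :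
    QuantumAffineSpace F n q →ₐ[F] QuantumAffineSpace F n q :=
  lift (fun i => QX F n q (π i)) fun i j _ => by rw [QX_mul_QX hq, ← h]

theorem eq_one_of_forall_isScalarAut (hq : MultAntisym F q)
    (H : ∀ σ : QuantumAffineSpace F n q ≃ₐ[F] QuantumAffineSpace F n q, IsScalarAut F n q σ)
    (π : Equiv.Perm (Fin n)) (h : ∀ i j, q i j = q (π i) (π j)) : π = 1 := by
  have h' : ∀ i j, q i j = q (π.symm i) (π.symm j) := fun i j => by
    rw [h (π.symm i), Equiv.apply_symm_apply, Equiv.apply_symm_apply]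
  obtain ⟨a, -, ha⟩ := H (AlgEquiv.ofAlgHom (permHom hq π h) (permHom hq π.symm h')
    (algHom_ext fun i => by simp [permHom]) (algHom_ext fun i => by simp [permHom]))
  refine Equiv.ext fun i => ?_
  by_contra hne
  have := congrArg (fun x => (basis hq).repr x {π i}) (ha i)
  rw [Equiv.Perm.one_apply] at hne
  simp [permHom, repr_QX, Ne.symm hne] at this

end Construction

end QuantumAffineSpace

end QuantumAffineSpace

theorem triviality_of_aut_one_entry_one (F : Type*) [Field F] [CharZero F]
    (n : ℕ) (hn : 3 ≤ n) (q : Fin n → Fin n → F) (hq : MultAntisym F q)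
    (i' j' : Fin n) (hij : i' < j') (hone : q i' j' = 1)
    (hq1 : ∀ i j : Fin n, i < j → (i, j) ≠ (i', j') → q i j ≠ 1) :
    (∀ σ : QuantumAffineSpace F n q ≃ₐ[F] QuantumAffineSpace F n q, IsScalarAut F n q σ) ↔
      (LambdaEmpty F q ∧
        ¬ ∃ π₁ π₂ : Equiv.Perm (Fin n),
            (π₁ = 1 ∨ π₁ = Equiv.swap i' j') ∧
            π₂ i' = i' ∧ π₂ j' = j' ∧ π₂ ≠ 1 ∧
            (∀ r : Fin n, r ≠ i' → r ≠ j' →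
              q i' r = q (π₁ i') (π₂ r) ∧ q j' r = q (π₁ j') (π₂ r)) ∧
            (∀ r s : Fin n, r ≠ i' → r ≠ j' → s ≠ i' → s ≠ j' →
              q r s = q (π₂ r) (π₂ s))) := by
  have hne : ∀ a b : Fin n, a ≠ b → ¬(a = i' ∧ b = j') → ¬(a = j' ∧ b = i') → q a b ≠ 1 := by
    intro a b hab h₁ h₂
    rcases lt_or_gt_of_ne hab with h | h
    · exact hq1 a b h fun e => h₁ (Prod.mk.inj e)
    · rw [hq.2.2 b a]
      exact inv_ne_one.2 (hq1 b a h fun e => h₂ (Prod.mk.inj e).symm)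
  constructor
  · intro H
    refine ⟨QuantumAffineSpace.lambdaEmpty_of_forall_isScalarAut hq H, ?_⟩
    rintro ⟨π₁, π₂, hπ₁, hi, hj, hπ₂, hmix, hJ⟩
    have hpres : ∀ r, r ≠ i' → r ≠ j' → π₂ r ≠ i' ∧ π₂ r ≠ j' := fun r hri hrj =>
      ⟨fun h => hri (π₂.injective (h.trans hi.symm)),
        fun h => hrj (π₂.injective (h.trans hj.symm))⟩
    have hfix : ∀ r, r ≠ i' → r ≠ j' → π₁ r = r := fun r hri hrj => by
      rcases hπ₁ with rfl | rfl
      · rfl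
      · exact Equiv.swap_apply_of_ne_of_ne hri hrj
    have hJmap : ∀ r, r ≠ i' → r ≠ j' → (π₁ * π₂) r = π₂ r := fun r hri hrj =>
      hfix _ (hpres r hri hrj).1 (hpres r hri hrj).2
    have hpair : ∀ a, a = i' ∨ a = j' → (π₁ * π₂) a = π₁ a := by
      rintro a (rfl | rfl) <;> simp [hi, hj]
    have hmix' : ∀ a r, (a = i' ∨ a = j') → r ≠ i' → r ≠ j' →
        q a r = q ((π₁ * π₂) a) ((π₁ * π₂) r) := by
      intro a r ha hri hrj
      rw [hpair a ha, hJmap r hri hrj]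
      rcases ha with rfl | rfl
      exacts [(hmix r hri hrj).1, (hmix r hri hrj).2]
    have hone' : q j' i' = 1 := by rw [hq.2.2 i' j', hone, inv_one]
    have hsymm : ∀ a b, q a b = q ((π₁ * π₂) a) ((π₁ * π₂) b) := by
      intro a b
      by_cases ha : a = i' ∨ a = j'
      · by_cases hb : b = i' ∨ b = j'
        · rw [hpair a ha, hpair b hb]
          rcases hπ₁ with rfl | rfl
          · rfl
          · rcases ha with rfl | rfl <;> rcases hb with rfl | rfl <;>
              simp [hone, hone', hq.2.1]
        · exact hmix' a b ha (fun h => hb (.inl h)) fun h => hb (.inr h)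
      · have hai : a ≠ i' := fun h => ha (.inl h)
        have haj : a ≠ j' := fun h => ha (.inr h)
        by_cases hb : b = i' ∨ b = j'
        · rw [hq.2.2 b a, hmix' b a hb hai haj, ← hq.2.2]
        · have hbi : b ≠ i' := fun h => hb (.inl h)
          have hbj : b ≠ j' := fun h => hb (.inr h)
          rw [hJmap a hai haj, hJmap b hbi hbj]
          exact hJ a b hai haj hbi hbj
    have hid := QuantumAffineSpace.eq_one_of_forall_isScalarAut hq H _ hsymm
    refine hπ₂ (Equiv.ext fun r => ?_)
    by_cases hri : r = i'
    · rw [hri, hi, Equiv.Perm.one_apply]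
    · by_cases hrj : r = j'
      · rw [hrj, hj, Equiv.Perm.one_apply]
      · rw [← hJmap r hri hrj, hid]
  · rintro ⟨hΛ, hπ⟩ σ
    refine QuantumAffineSpace.isScalarAut_of_lambdaEmpty hq hΛ fun τ i => ?_
    have hnc : ∀ a, ∃ b, q a b ≠ 1 := by
      intro a
      obtain ⟨r, hr⟩ : ∃ r, r ∉ ({i', j'} : Finset (Fin n)) := by
        by_contra! h
        have h₁ := Finset.card_le_card fun r (_ : r ∈ Finset.univ) => h r
        have h₂ := Finset.card_le_two (a := i') (b := j')
        rw [Finset.card_univ, Fintype.card_fin] at h₁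
        omega
      simp only [Finset.mem_insert, Finset.mem_singleton, not_or] at hr
      by_cases har : a = r
      · exact ⟨i', hne a i' (har ▸ hr.1) (fun h => hij.ne h.2) fun h => hr.2 (har ▸ h.1)⟩
      · exact ⟨r, hne a r har (fun h => hr.2 h.2) fun h => hr.1 h.2⟩
    obtain ⟨π, hsymm, hsupp⟩ := QuantumAffineSpace.exists_perm (σ := τ) hq hnc
    suffices π = 1 by simpa [this] using hsupp i
    have hπij : (π i' = i' ∧ π j' = j') ∨ (π i' = j' ∧ π j' = i') := by
      by_contra! h
      exact hne (π i') (π j') (π.injective.ne hij.ne) (fun e => h.1 e.1 e.2)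
        (fun e => h.2 e.1 e.2) (by rw [← hsymm, hone])
    rcases hπij with ⟨hi, hj⟩ | ⟨hi, hj⟩
    · by_contra hπ1
      exact hπ ⟨1, π, .inl rfl, hi, hj, hπ1,
        fun r _ _ => ⟨by rw [Equiv.Perm.one_apply, hsymm i' r, hi],
          by rw [Equiv.Perm.one_apply, hsymm j' r, hj]⟩, fun r s _ _ _ _ => hsymm r s⟩
    · exfalso
      have hJmap : ∀ r, r ≠ i' → r ≠ j' → (Equiv.swap i' j' * π) r = π r := fun r hri hrj =>
        Equiv.swap_apply_of_ne_of_ne (fun h => hrj (π.injective (h.trans hj.symm)))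
          fun h => hri (π.injective (h.trans hi.symm))
      have hπ₂ : Equiv.swap i' j' * π = 1 := by
        by_contra hπ1
        refine hπ ⟨Equiv.swap i' j', Equiv.swap i' j' * π, .inr rfl, by simp [hi], by simp [hj],
          hπ1, fun r hri hrj => ?_, fun r s hri hrj hsi hsj => ?_⟩
        · rw [hJmap r hri hrj, Equiv.swap_apply_left, Equiv.swap_apply_right, hsymm i' r,
            hsymm j' r, hi, hj]
          exact ⟨rfl, rfl⟩
        · rw [hJmap r hri hrj, hJmap s hsi hsj, hsymm r s]
      refine hΛ i' (Pi.single j' 1) ⟨by simp [hij.ne], fun r hri => ?_⟩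
      rw [Finset.prod_eq_single j' (fun k _ hk => by simp [hk]) (by simp), Pi.single_eq_same,
        pow_one]
      by_cases hrj : r = j'
      · rw [hrj, hone, hq.2.1]
      · have hr : π r = r := by rw [← hJmap r hri hrj, hπ₂, Equiv.Perm.one_apply]
        rw [hsymm i' r, hi, hr]
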